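/- arXiv:2407.18082 — 2 statements merged into one kernel-verified Lean document; each statement's English description precedes it below -/
import Mathlib

section
/- Let E ⊆ ℝ be an unbounded open interval (a half-line or all of ℝ) and let I, I′ ⊆ E be two bounded subintervals of positive length. Then there exists a constant C > 0, depending only on I and I′, such that for every measurable f : E → ℝ integrable on every bounded measurable subset of E one has | avg_I f − avg_{I′} f | ≤ C |f|_{Ḣ^{1/2}(E)}. In particular, replacing the averaging window I by I′ changes the quantity |f|_{Ḣ^{1/2}(E)} + |avg f| only up to uniform equivalence, so the choice of window is immaterial. -/
open MeasureTheory Set Filter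
open scoped ENNReal BigOperators

noncomputable def screenedSeminorm (I : Set ℝ) (r : ℝ) (f : ℝ → ℝ) : ℝ≥0∞ :=
  (∫⁻ x in I, ∫⁻ y in I ∩ Set.Ioo (x - r) (x + r),
      ENNReal.ofReal ((f y - f x) ^ 2 / (y - x) ^ 2)) ^ (1 / 2 : ℝ)

def LocIntOn (I : Set ℝ) (f : ℝ → ℝ) : Prop :=
  ∀ s : Set ℝ, s ⊆ I → MeasurableSet s → Bornology.IsBounded s →
    MeasureTheory.IntegrableOn f s

noncomputable def avgOn (J : Set ℝ) (f : ℝ → ℝ) : ℝ :=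
  (MeasureTheory.volume J).toReal⁻¹ * ∫ x in J, f x

/-- The double integral of `|f y - f x|` over `x ∈ A`, `y ∈ B`. -/
noncomputable def crossOscillation (f : ℝ → ℝ) (A B : Set ℝ) : ℝ≥0∞ :=
  ∫⁻ x in A, ∫⁻ y in B, ‖f y - f x‖ₑ

/-- The oscillation between `A` and `B` is controlled, uniformly in `f`, by the screened seminorm
on `E`. -/
def OscControlled (E A B : Set ℝ) : Prop :=
  ∃ C : ℝ≥0∞, C ≠ ∞ ∧ ∀ f : ℝ → ℝ, Measurable f →
    crossOscillation f A B ≤ C * screenedSeminorm E 1 f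

lemma OscControlled.mono {E A B A' B' : Set ℝ} (h : OscControlled E A B) (hA : A' ⊆ A)
    (hB : B' ⊆ B) : OscControlled E A' B' := by
  obtain ⟨C, hC, h⟩ := h
  refine ⟨C, hC, fun f hf => le_trans ?_ (h f hf)⟩
  exact (lintegral_mono_set hA).trans (lintegral_mono fun x => lintegral_mono_set hB)

lemma OscControlled.union_left {E A A' B : Set ℝ} (h : OscControlled E A B)
    (h' : OscControlled E A' B) : OscControlled E (A ∪ A') B := by
  obtain ⟨C, hC, h⟩ := h
  obtain ⟨C', hC', h'⟩ := h'
  refine ⟨C + C', ENNReal.add_ne_top.2 ⟨hC, hC'⟩, fun f hf => ?_⟩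
  rw [add_mul]
  exact (lintegral_union_le _ _ _).trans (add_le_add (h f hf) (h' f hf))

lemma measurable_setLIntegral_enorm_sub {f : ℝ → ℝ} (hf : Measurable f) (B : Set ℝ) :
    Measurable fun x => ∫⁻ y in B, ‖f y - f x‖ₑ :=
  Measurable.lintegral_prod_right' (f := fun p : ℝ × ℝ => ‖f p.2 - f p.1‖ₑ) (by fun_prop)

lemma OscControlled.union_right {E A B B' : Set ℝ} (h : OscControlled E A B)
    (h' : OscControlled E A B') : OscControlled E A (B ∪ B') := by
  obtain ⟨C, hC, h⟩ := h
  obtain ⟨C', hC', h'⟩ := h'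
  refine ⟨C + C', ENNReal.add_ne_top.2 ⟨hC, hC'⟩, fun f hf => ?_⟩
  rw [add_mul]
  refine le_trans ?_ (add_le_add (h f hf) (h' f hf))
  unfold crossOscillation
  rw [← lintegral_add_left (measurable_setLIntegral_enorm_sub hf B)]
  exact lintegral_mono fun x => lintegral_union_le _ _ _

lemma volume_mul_crossOscillation_le {f : ℝ → ℝ} (hf : Measurable f) (A B O : Set ℝ) :
    volume O * crossOscillation f A B ≤
      volume A * crossOscillation f B O + volume B * crossOscillation f A O := by
  have hO := measurable_setLIntegral_enorm_sub hf O
  have pointwise : ∀ x y, volume O * ‖f y - f x‖ₑ ≤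
      (∫⁻ z in O, ‖f z - f y‖ₑ) + ∫⁻ z in O, ‖f z - f x‖ₑ := by
    intro x y
    rw [← lintegral_add_left (by fun_prop), mul_comm, ← setLIntegral_const]
    refine lintegral_mono fun z => ?_
    calc ‖f y - f x‖ₑ = ‖(f z - f x) - (f z - f y)‖ₑ := by congr 1; ring
      _ ≤ ‖f z - f x‖ₑ + ‖f z - f y‖ₑ := enorm_sub_le
      _ = _ := add_comm _ _
  calc volume O * crossOscillation f A B
      = ∫⁻ x in A, ∫⁻ y in B, volume O * ‖f y - f x‖ₑ := by
        unfold crossOscillation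
        rw [← lintegral_const_mul _ (measurable_setLIntegral_enorm_sub hf B)]
        refine lintegral_congr fun x => ?_
        rw [lintegral_const_mul _ (by fun_prop)]
    _ ≤ ∫⁻ x in A, ∫⁻ y in B, ((∫⁻ z in O, ‖f z - f y‖ₑ) + ∫⁻ z in O, ‖f z - f x‖ₑ) :=
        lintegral_mono fun x => lintegral_mono fun y => pointwise x y
    _ = ∫⁻ x in A, (crossOscillation f B O + (∫⁻ z in O, ‖f z - f x‖ₑ) * volume B) := by
        refine lintegral_congr fun x => ?_
        rw [lintegral_add_left hO, setLIntegral_const, crossOscillation]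
    _ = _ := by
        rw [lintegral_add_left measurable_const, setLIntegral_const,
          lintegral_mul_const _ hO, crossOscillation, crossOscillation]
        ring

lemma OscControlled.trans {E A B O : Set ℝ} (hA : OscControlled E A O) (hB : OscControlled E B O)
    (hO₀ : volume O ≠ 0) (hO : volume O ≠ ∞) (hvA : volume A ≠ ∞) (hvB : volume B ≠ ∞) :
    OscControlled E A B := by
  obtain ⟨C, hC, hA⟩ := hA
  obtain ⟨C', hC', hB⟩ := hB
  refine ⟨(volume O)⁻¹ * (volume A * C' + volume B * C), by finiteness, fun f hf => ?_⟩
  rw [mul_assoc, ← ENNReal.div_eq_inv_mul,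
    ENNReal.le_div_iff_mul_le (Or.inl hO₀) (Or.inl hO), mul_comm]
  refine (volume_mul_crossOscillation_le hf A B O).trans ?_
  rw [add_mul, mul_assoc, mul_assoc]
  gcongr
  exacts [hB f hf, hA f hf]

lemma lintegral_sq_le_of_measure_univ_le_one {α : Type*} [MeasurableSpace α] {μ : Measure α}
    (hμ : μ univ ≤ 1) {g : α → ℝ≥0∞} (hg : AEMeasurable g μ) :
    (∫⁻ x, g x ∂μ) ^ 2 ≤ ∫⁻ x, g x ^ 2 ∂μ := by
  have h := ENNReal.lintegral_mul_le_Lp_mul_Lq μ Real.HolderConjugate.two_two hg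
    (aemeasurable_const (b := (1 : ℝ≥0∞)))
  simp only [Pi.mul_apply, mul_one, ENNReal.one_rpow, lintegral_const, one_mul] at h
  have h' : ∫⁻ x, g x ∂μ ≤ (∫⁻ x, g x ^ (2 : ℝ) ∂μ) ^ (1 / 2 : ℝ) :=
    h.trans (mul_le_of_le_one_right' (ENNReal.rpow_le_one hμ (by norm_num)))
  have h'' := pow_le_pow_left' h' 2
  rw [← ENNReal.rpow_natCast (_ ^ (1 / 2 : ℝ)), ← ENNReal.rpow_mul] at h''
  simpa using h''

lemma oscControlled_Ioo_of_length_le_one {E : Set ℝ} {p q : ℝ} (hpq : q - p ≤ 1)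
    (hE : Ioo p q ⊆ E) : OscControlled E (Ioo p q) (Ioo p q) := by
  refine ⟨1, ENNReal.one_ne_top, fun f hf => ?_⟩
  have hμ : (volume.restrict (Ioo p q)) univ ≤ 1 := by
    rw [Measure.restrict_apply_univ, Real.volume_Ioo]
    exact ENNReal.ofReal_le_one.2 hpq
  rw [one_mul, screenedSeminorm, one_div, ENNReal.le_rpow_inv_iff (by norm_num)]
  calc crossOscillation f (Ioo p q) (Ioo p q) ^ (2 : ℝ)
      = crossOscillation f (Ioo p q) (Ioo p q) ^ 2 := by norm_num
    _ ≤ ∫⁻ x in Ioo p q, (∫⁻ y in Ioo p q, ‖f y - f x‖ₑ) ^ 2 :=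
        lintegral_sq_le_of_measure_univ_le_one hμ
          (measurable_setLIntegral_enorm_sub hf _).aemeasurable
    _ ≤ ∫⁻ x in Ioo p q, ∫⁻ y in Ioo p q, ‖f y - f x‖ₑ ^ 2 :=
        lintegral_mono fun x => lintegral_sq_le_of_measure_univ_le_one hμ (by fun_prop)
    _ ≤ ∫⁻ x in Ioo p q, ∫⁻ y in E ∩ Ioo (x - 1) (x + 1),
          ENNReal.ofReal ((f y - f x) ^ 2 / (y - x) ^ 2) := by
        refine setLIntegral_mono' measurableSet_Ioo fun x hx => ?_
        refine le_trans (setLIntegral_mono' measurableSet_Ioo fun y hy => ?_)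
          (lintegral_mono_set fun y hy =>
            ⟨hE hy, by linarith [hx.2, hy.1], by linarith [hx.1, hy.2]⟩)
        rw [← ofReal_norm, ← ENNReal.ofReal_pow (norm_nonneg _), Real.norm_eq_abs, sq_abs]
        refine ENNReal.ofReal_le_ofReal ?_
        rcases eq_or_ne y x with rfl | hne
        · simp
        · have hpos : 0 < (y - x) ^ 2 := by have := sub_ne_zero.2 hne; positivity
          have hle : (y - x) ^ 2 ≤ 1 := by
            rw [sq_le_one_iff_abs_le_one, abs_le]
            constructor <;> linarith [hx.1, hx.2, hy.1, hy.2]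
          rw [le_div_iff₀ hpos]
          exact mul_le_of_le_one_right (sq_nonneg _) hle
    _ ≤ _ := lintegral_mono_set hE

lemma oscControlled_Ioo {E : Set ℝ} {p q : ℝ} (hE : Ioo p q ⊆ E) :
    OscControlled E (Ioo p q) (Ioo p q) := by
  obtain ⟨n, hn⟩ := pow_unbounded_of_one_lt (q - p) (show (1 : ℝ) < 3 / 2 by norm_num)
  induction n generalizing p q with
  | zero => exact oscControlled_Ioo_of_length_le_one (by simpa using hn.le) hE
  | succ n ih =>
    rcases le_or_gt q p with hqp | hpq
    · exact oscControlled_Ioo_of_length_le_one (by linarith) hE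
    set u := p + (q - p) / 3 with hu
    set v := p + 2 * (q - p) / 3 with hv
    rw [pow_succ] at hn
    have left := ih (p := p) (q := v) ((Ioo_subset_Ioo_right (by linarith)).trans hE)
      (by linarith)
    have right := ih (p := u) (q := q) ((Ioo_subset_Ioo_left (by linarith)).trans hE)
      (by linarith)
    have left_mid : OscControlled E (Ioo p v) (Ioo u v) :=
      left.mono subset_rfl (Ioo_subset_Ioo_left (by linarith))
    have right_mid : OscControlled E (Ioo u q) (Ioo u v) :=
      right.mono subset_rfl (Ioo_subset_Ioo_right (by linarith))
    have hvol : volume (Ioo u v) ≠ 0 := by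
      rw [Real.volume_Ioo, Ne, ENNReal.ofReal_eq_zero]
      linarith
    have left_right : OscControlled E (Ioo p v) (Ioo u q) :=
      left_mid.trans right_mid hvol (by simp) (by simp) (by simp)
    have right_left : OscControlled E (Ioo u q) (Ioo p v) :=
      right_mid.trans left_mid hvol (by simp) (by simp) (by simp)
    have hcover : Ioo p q ⊆ Ioo p v ∪ Ioo u q := by
      intro x hx
      rcases lt_or_ge x v with h | h
      · exact Or.inl ⟨hx.1, h⟩
      · exact Or.inr ⟨by linarith, hx.2⟩
    exact ((left.union_right left_right).union_left (right_left.union_right right)).mono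
      hcover hcover

lemma screenedSeminorm_congr_ae {E : Set ℝ} {r : ℝ} {f g : ℝ → ℝ}
    (h : f =ᵐ[volume.restrict E] g) : screenedSeminorm E r f = screenedSeminorm E r g := by
  unfold screenedSeminorm
  congr 1
  refine lintegral_congr_ae ?_
  filter_upwards [h] with x hx
  refine lintegral_congr_ae ?_
  filter_upwards [ae_restrict_of_ae_restrict_of_subset inter_subset_left h] with y hy
  rw [hx, hy]

lemma avgOn_congr_ae {E J : Set ℝ} {f g : ℝ → ℝ} (hJ : J ⊆ E)
    (h : f =ᵐ[volume.restrict E] g) : avgOn J f = avgOn J g := by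
  unfold avgOn
  rw [integral_congr_ae (ae_restrict_of_ae_restrict_of_subset hJ h)]

lemma LocIntOn.aemeasurable {E : Set ℝ} {f : ℝ → ℝ} (hE : MeasurableSet E) (hf : LocIntOn E f) :
    AEMeasurable f (volume.restrict E) := by
  have hcover : E = ⋃ n : ℕ, E ∩ Metric.ball 0 n := by
    rw [← inter_iUnion, Metric.iUnion_ball_nat, inter_univ]
  rw [hcover, aemeasurable_iUnion_iff]
  exact fun n => (hf _ inter_subset_left (hE.inter measurableSet_ball)
    (Metric.isBounded_ball.subset inter_subset_right)).aemeasurable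

lemma enorm_avgOn_sub_avgOn_le {J K : Set ℝ} {f : ℝ → ℝ} (hJ : IntegrableOn f J)
    (hK : IntegrableOn f K) (hJ₀ : volume J ≠ 0) (hK₀ : volume K ≠ 0) (hvJ : volume J ≠ ∞)
    (hvK : volume K ≠ ∞) :
    ‖avgOn J f - avgOn K f‖ₑ ≤ (volume J * volume K)⁻¹ * crossOscillation f J K := by
  have hjpos := ENNReal.toReal_pos hJ₀ hvJ
  have hkpos := ENNReal.toReal_pos hK₀ hvK
  have inner : ∀ x, ∫ y in K, (f y - f x) = (∫ y in K, f y) - (volume K).toReal * f x := by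
    intro x
    rw [integral_sub hK (integrableOn_const hvK), setIntegral_const, smul_eq_mul, measureReal_def]
  have double : ∫ x in J, ∫ y in K, (f y - f x) =
      (volume J).toReal * (∫ y in K, f y) - (volume K).toReal * ∫ x in J, f x := by
    have hconst : IntegrableOn (fun _ => ∫ y in K, f y) J := integrableOn_const hvJ
    simp_rw [inner]
    rw [integral_sub hconst (hJ.const_mul _), setIntegral_const, smul_eq_mul,
      integral_const_mul, measureReal_def]
  have hbound : ‖∫ x in J, ∫ y in K, (f y - f x)‖ₑ ≤ crossOscillation f J K :=
    (enorm_integral_le_lintegral_enorm _).trans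
      (lintegral_mono fun x => enorm_integral_le_lintegral_enorm _)
  rw [← ENNReal.div_eq_inv_mul, ENNReal.le_div_iff_mul_le (Or.inl (by positivity))
    (Or.inl (by finiteness))]
  refine le_trans (le_of_eq ?_) hbound
  rw [double]
  have hvol : volume J * volume K = ‖(volume J).toReal * (volume K).toReal‖ₑ := by
    rw [enorm_mul, Real.enorm_of_nonneg hjpos.le, Real.enorm_of_nonneg hkpos.le,
      ENNReal.ofReal_toReal hvJ, ENNReal.ofReal_toReal hvK]
  rw [hvol, ← enorm_mul, ← enorm_neg]
  congr 1
  unfold avgOn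
  field_simp
  ring

/-- on an unbounded open interval `E` (a half-line or all of `ℝ`), for any
two bounded subintervals `I = (a, b)` and `I′ = (a′, b′)` of positive length there is a
constant `C > 0` (depending only on the two windows) such that
`|avg_I f − avg_{I′} f| ≤ C |f|_{Ḣ^{1/2}(E)}` for every locally integrable `f` on `E`;
hence the choice of averaging window is immaterial. -/
theorem statement4 (E : Set ℝ)
    (hE : (∃ a : ℝ, E = Set.Ioi a) ∨ (∃ a : ℝ, E = Set.Iio a) ∨ E = Set.univ)
    (a b a' b' : ℝ) (hab : a < b) (hab' : a' < b')
    (hI : Set.Ioo a b ⊆ E) (hI' : Set.Ioo a' b' ⊆ E) :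
    ∃ C : ℝ, 0 < C ∧ ∀ f : ℝ → ℝ, LocIntOn E f →
      ENNReal.ofReal |avgOn (Set.Ioo a b) f - avgOn (Set.Ioo a' b') f| ≤
        ENNReal.ofReal C * screenedSeminorm E 1 f := by
  have hEmeas : MeasurableSet E := by
    rcases hE with ⟨c, rfl⟩ | ⟨c, rfl⟩ | rfl <;> measurability
  have hEconn : E.OrdConnected := by
    rcases hE with ⟨c, rfl⟩ | ⟨c, rfl⟩ | rfl <;> infer_instance
  have hull : Ioo (min a a') (max b b') ⊆ E := by
    intro x hx
    obtain ⟨u, hu, hux⟩ : ∃ u ∈ E, u ≤ x := by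
      rcases min_lt_iff.1 hx.1 with h | h
      · obtain ⟨u, hu, hu'⟩ := exists_between (lt_min hab h)
        exact ⟨u, hI ⟨hu, hu'.trans_le (min_le_left _ _)⟩, (hu'.trans_le (min_le_right _ _)).le⟩
      · obtain ⟨u, hu, hu'⟩ := exists_between (lt_min hab' h)
        exact ⟨u, hI' ⟨hu, hu'.trans_le (min_le_left _ _)⟩, (hu'.trans_le (min_le_right _ _)).le⟩
    obtain ⟨v, hv, hxv⟩ : ∃ v ∈ E, x ≤ v := by
      rcases lt_max_iff.1 hx.2 with h | h
      · obtain ⟨v, hv, hv'⟩ := exists_between (max_lt hab h)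
        exact ⟨v, hI ⟨(le_max_left _ _).trans_lt hv, hv'⟩, ((le_max_right _ _).trans_lt hv).le⟩
      · obtain ⟨v, hv, hv'⟩ := exists_between (max_lt hab' h)
        exact ⟨v, hI' ⟨(le_max_left _ _).trans_lt hv, hv'⟩, ((le_max_right _ _).trans_lt hv).le⟩
    exact hEconn.out hu hv ⟨hux, hxv⟩
  obtain ⟨C, hC, hosc⟩ : OscControlled E (Ioo a b) (Ioo a' b') :=
    (oscControlled_Ioo hull).mono (Ioo_subset_Ioo (min_le_left _ _) (le_max_left _ _))
      (Ioo_subset_Ioo (min_le_right _ _) (le_max_right _ _))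
  have hvol : volume (Ioo a b) ≠ 0 := by simpa using hab
  have hvol' : volume (Ioo a' b') ≠ 0 := by simpa using hab'
  set D : ℝ≥0∞ := (volume (Ioo a b) * volume (Ioo a' b'))⁻¹ * C with hD
  have hDtop : D ≠ ∞ :=
    ENNReal.mul_ne_top (ENNReal.inv_ne_top.2 (mul_ne_zero hvol hvol')) hC
  refine ⟨D.toReal + 1, by positivity, fun f hf => ?_⟩
  have hfE := hf.aemeasurable hEmeas
  have hfg := hfE.ae_eq_mk
  set g := hfE.mk f
  rw [avgOn_congr_ae hI hfg, avgOn_congr_ae hI' hfg, screenedSeminorm_congr_ae hfg,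
    ← Real.norm_eq_abs, ofReal_norm]
  have hg : ∀ p q, Ioo p q ⊆ E → IntegrableOn g (Ioo p q) := fun p q h =>
    (hf _ h measurableSet_Ioo (Metric.isBounded_Ioo p q)).congr
      (ae_restrict_of_ae_restrict_of_subset h hfg)
  calc ‖avgOn (Ioo a b) g - avgOn (Ioo a' b') g‖ₑ
      ≤ (volume (Ioo a b) * volume (Ioo a' b'))⁻¹ * crossOscillation g (Ioo a b) (Ioo a' b') :=
        enorm_avgOn_sub_avgOn_le (hg _ _ hI) (hg _ _ hI') hvol hvol' (by simp) (by simp)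
    _ ≤ D * screenedSeminorm E 1 g := by
        rw [hD, mul_assoc]
        gcongr
        exact hosc g hfE.measurable_mk
    _ ≤ _ := by
        gcongr
        rw [ENNReal.le_ofReal_iff_toReal_le hDtop (by positivity)]
        linarith
end

section
/- Let I ⊆ ℝ be a nonempty open interval that is either bounded or a half-line. Then there exists a constant C > 0, depending only on I, such that for every measurable f : I → ℝ that is integrable on every bounded measurable subset of I and satisfies |f|_{Ḣ^{1/2}(I)} < ∞, there exists a measurable f̃ : ℝ → ℝ, integrable on every bounded measurable subset of ℝ, with f̃ = f almost everywhere on I and |f̃|_{Ḣ^{1/2}(ℝ)} ≤ C |f|_{Ḣ^{1/2}(I)}. -/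
open MeasureTheory Set Filter
open scoped ENNReal BigOperators

/-- The kernel of the screened seminorm with radius `1`. -/
noncomputable def screenedKernel (f : ℝ → ℝ) (x y : ℝ) : ℝ≥0∞ :=
  (Ioo (x - 1) (x + 1)).indicator
    (fun y => ENNReal.ofReal ((f y - f x) ^ 2 / (y - x) ^ 2)) y

lemma screenedSeminorm_one_eq (I : Set ℝ) (f : ℝ → ℝ) :
    screenedSeminorm I 1 f = (∫⁻ x in I, ∫⁻ y in I, screenedKernel f x y) ^ (1 / 2 : ℝ) := by
  unfold screenedSeminorm screenedKernel
  congr 1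
  refine lintegral_congr fun x => ?_
  rw [setLIntegral_indicator measurableSet_Ioo, inter_comm]

/-- Comparison of the weighted kernel at `(x', y')` with the kernel at `(x, y)`, when the function
values agree and `(x', y')` is further apart than `(x, y)`. -/
lemma ofReal_mul_screenedKernel_le {f g : ℝ → ℝ} {x y x' y' w : ℝ} (hw : 0 ≤ w)
    (hx : g x' = f x) (hy : g y' = f y) (hd : |y - x| ≤ |y' - x'|)
    (hwd : w * (y - x) ^ 2 ≤ (y' - x') ^ 2) :
    ENNReal.ofReal w * screenedKernel g x' y' ≤ screenedKernel f x y := by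
  unfold screenedKernel
  by_cases h : y' ∈ Ioo (x' - 1) (x' + 1)
  · have h1 : |y' - x'| < 1 := abs_lt.2 ⟨by linarith [h.1], by linarith [h.2]⟩
    have h2 := abs_lt.1 (hd.trans_lt h1)
    have h' : y ∈ Ioo (x - 1) (x + 1) := ⟨by linarith [h2.1], by linarith [h2.2]⟩
    rw [indicator_of_mem h, indicator_of_mem h', hx, hy, ← ENNReal.ofReal_mul hw]
    refine ENNReal.ofReal_le_ofReal ?_
    rcases eq_or_ne y x with rfl | hne
    · simp
    · have hpos : 0 < (y - x) ^ 2 := by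
        have := sub_ne_zero.2 hne
        positivity
      have hpos' : 0 < (y' - x') ^ 2 := hpos.trans_le (sq_le_sq.2 hd)
      rw [← mul_div_assoc, div_le_div_iff₀ hpos' hpos]
      calc w * (f y - f x) ^ 2 * (y - x) ^ 2 = (f y - f x) ^ 2 * (w * (y - x) ^ 2) := by ring
        _ ≤ _ := by gcongr
  · rw [indicator_of_notMem h, mul_zero]
    exact zero_le

/-- Extension by composition with a map `ψ` that carries almost all of `I` onto almost all of the
complement of `I` and does not increase the kernel `dx dy / (x - y) ^ 2`. -/
lemma exists_extension_of_involution {I I₀ : Set ℝ} {ψ ψ' : ℝ → ℝ}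
    (hI : MeasurableSet I) (hI₀ : MeasurableSet I₀) (hsub : I₀ ⊆ I)
    (hψ : Measurable ψ) (hψ' : Measurable ψ')
    (hderiv : ∀ u ∈ I₀, HasDerivAt ψ (ψ' u) u)
    (hinv : ∀ u ∈ I₀, ψ (ψ u) = u) (hmaps : ∀ u ∈ I₀, ψ u ∉ I)
    (himage : (Iᶜ : Set ℝ) =ᵐ[volume] ψ '' I₀)
    (hdist : ∀ u ∈ I₀, ∀ v ∈ I₀, |v - u| ≤ |ψ v - ψ u|)
    (hker : ∀ u ∈ I₀, ∀ v ∈ I₀, |ψ' u| * |ψ' v| * (v - u) ^ 2 ≤ (ψ v - ψ u) ^ 2)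
    (hdist' : ∀ u ∈ I₀, ∀ x ∈ I, |u - x| ≤ |ψ u - x|)
    (hker' : ∀ u ∈ I₀, ∀ x ∈ I, |ψ' u| * (u - x) ^ 2 ≤ (ψ u - x) ^ 2)
    (hbdd : ∀ s : Set ℝ, Bornology.IsBounded s → Bornology.IsBounded (I₀ ∩ ψ ⁻¹' s))
    (hbdd' : ∀ s : Set ℝ, Bornology.IsBounded s → ∃ M : ℝ, ∀ u ∈ I₀ ∩ ψ ⁻¹' s, |ψ' u| ≤ M) :
    ∃ C : ℝ, 0 < C ∧ ∀ f : ℝ → ℝ, LocIntOn I f → screenedSeminorm I 1 f < ⊤ →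
      ∃ ftilde : ℝ → ℝ, LocIntOn Set.univ ftilde ∧
        (∀ᵐ x ∂volume.restrict I, ftilde x = f x) ∧
        screenedSeminorm Set.univ 1 ftilde ≤ ENNReal.ofReal C * screenedSeminorm I 1 f := by
  classical
  have hinj : InjOn ψ I₀ := fun u hu v hv h => by rw [← hinv u hu, h, hinv v hv]
  have hsplit (F : ℝ → ℝ≥0∞) : ∫⁻ x, F x =
      (∫⁻ x in I, F x) + ∫⁻ u in I₀, ENNReal.ofReal |ψ' u| * F (ψ u) := by
    rw [← lintegral_add_compl F hI, setLIntegral_congr himage,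
      lintegral_image_eq_lintegral_abs_deriv_mul hI₀
        (fun u hu => (hderiv u hu).hasDerivWithinAt) hinj]
  refine ⟨2, two_pos, fun f hf _ => ?_⟩
  set g : ℝ → ℝ := I.piecewise f (f ∘ ψ) with hg
  have hgI : ∀ x ∈ I, g x = f x := fun x hx => piecewise_eq_of_mem _ _ _ hx
  have hgψ : ∀ u ∈ I₀, g (ψ u) = f u := fun u hu => by
    rw [hg, piecewise_eq_of_notMem _ _ _ (hmaps u hu), Function.comp_apply, hinv u hu]
  refine ⟨g, ?_, (ae_restrict_mem hI).mono hgI, ?_⟩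
  · intro s _ hs hsb
    have h₁ : IntegrableOn g (s ∩ I) :=
      (hf _ inter_subset_right (hs.inter hI) (hsb.subset inter_subset_left)).congr_fun
        (fun x hx => (hgI x hx.2).symm) (hs.inter hI)
    have hpre : MeasurableSet (I₀ ∩ ψ ⁻¹' s) := hI₀.inter (hψ hs)
    have h₂ : IntegrableOn g (ψ '' (I₀ ∩ ψ ⁻¹' s)) := by
      rw [integrableOn_image_iff_integrableOn_abs_deriv_smul hpre
        (fun u hu => (hderiv u hu.1).hasDerivWithinAt) (hinj.mono inter_subset_left)]
      obtain ⟨M, hM⟩ := hbdd' s hsb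
      have h₃ : IntegrableOn (fun u => |ψ' u| * f u) (I₀ ∩ ψ ⁻¹' s) := by
        refine Integrable.bdd_mul (c := M)
          (hf _ (inter_subset_left.trans hsub) hpre (hbdd s hsb))
          hψ'.abs.aestronglyMeasurable ?_
        filter_upwards [ae_restrict_mem hpre] with u hu
        simpa using hM u hu
      exact h₃.congr_fun (fun u hu => by simp only [smul_eq_mul, hgψ u hu.1]) hpre
    have h₄ : (s ∩ Iᶜ : Set ℝ) =ᵐ[volume] ψ '' (I₀ ∩ ψ ⁻¹' s) := by
      rw [image_inter_preimage, inter_comm (ψ '' I₀)]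
      exact (ae_eq_refl _).inter himage
    rw [← inter_union_compl s I]
    exact h₁.union (h₂.congr_set_ae h₄)
  · have hinner : ∀ x x' w : ℝ, 0 ≤ w →
        (∀ y ∈ I, ENNReal.ofReal w * screenedKernel g x' y ≤ screenedKernel f x y) →
        (∀ v ∈ I₀, ENNReal.ofReal (w * |ψ' v|) * screenedKernel g x' (ψ v)
          ≤ screenedKernel f x v) →
        ENNReal.ofReal w * ∫⁻ y, screenedKernel g x' y ≤ 2 * ∫⁻ y in I, screenedKernel f x y := by
      intro x x' w hw h₁ h₂
      rw [hsplit, mul_add, two_mul, ← lintegral_const_mul' _ _ ENNReal.ofReal_ne_top,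
        ← lintegral_const_mul' _ _ ENNReal.ofReal_ne_top]
      refine add_le_add (setLIntegral_mono' hI h₁) ?_
      refine (setLIntegral_mono' hI₀ fun v hv => ?_).trans (lintegral_mono_set hsub)
      rw [← mul_assoc, ← ENNReal.ofReal_mul hw]
      exact h₂ v hv
    have hmain : ∫⁻ x, ∫⁻ y, screenedKernel g x y ≤
        4 * ∫⁻ x in I, ∫⁻ y in I, screenedKernel f x y := by
      have h4 : (4 : ℝ≥0∞) = 2 + 2 := by norm_num
      rw [hsplit, h4, add_mul, ← lintegral_const_mul' _ _ ENNReal.ofNat_ne_top]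
      refine add_le_add (setLIntegral_mono' hI fun x hx => ?_)
        ((setLIntegral_mono' hI₀ fun u hu => ?_).trans (lintegral_mono_set hsub))
      · have := hinner x x 1 zero_le_one
          (fun y hy => ofReal_mul_screenedKernel_le zero_le_one (hgI x hx) (hgI y hy) le_rfl
            (by rw [one_mul]))
          (fun v hv => by
            rw [one_mul]
            exact ofReal_mul_screenedKernel_le (abs_nonneg _) (hgI x hx) (hgψ v hv)
              (hdist' v hv x hx) (hker' v hv x hx))
        simpa using this
      · refine hinner u (ψ u) |ψ' u| (abs_nonneg _) (fun y hy => ?_) (fun v hv => ?_)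
        · refine ofReal_mul_screenedKernel_le (abs_nonneg _) (hgψ u hu) (hgI y hy) ?_ ?_
          · rw [abs_sub_comm y, abs_sub_comm y]
            exact hdist' u hu y hy
          · rw [sub_sq_comm y, sub_sq_comm y]
            exact hker' u hu y hy
        · exact ofReal_mul_screenedKernel_le (by positivity) (hgψ u hu) (hgψ v hv)
            (hdist u hu v hv) (hker u hu v hv)
    rw [screenedSeminorm_one_eq, screenedSeminorm_one_eq, Measure.restrict_univ]
    refine (ENNReal.rpow_le_rpow hmain (by norm_num)).trans_eq ?_
    have h4 : (4 : ℝ≥0∞) = 2 ^ (2 : ℝ) := by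
      rw [ENNReal.rpow_ofNat]
      norm_num
    rw [ENNReal.mul_rpow_of_nonneg _ _ (by norm_num), h4, ← ENNReal.rpow_mul]
    norm_num

/-- Extension from a half-line by reflection in its endpoint. -/
lemma exists_extension_of_reflection {I : Set ℝ} {a : ℝ} (hI : MeasurableSet I)
    (hmaps : ∀ u ∈ I, 2 * a - u ∉ I)
    (himage : (Iᶜ : Set ℝ) =ᵐ[volume] (fun u => 2 * a - u) '' I)
    (hside : ∀ u ∈ I, ∀ x ∈ I, 0 ≤ (u - a) * (x - a)) :
    ∃ C : ℝ, 0 < C ∧ ∀ f : ℝ → ℝ, LocIntOn I f → screenedSeminorm I 1 f < ⊤ →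
      ∃ ftilde : ℝ → ℝ, LocIntOn Set.univ ftilde ∧
        (∀ᵐ x ∂volume.restrict I, ftilde x = f x) ∧
        screenedSeminorm Set.univ 1 ftilde ≤ ENNReal.ofReal C * screenedSeminorm I 1 f := by
  have hcross : ∀ u ∈ I, ∀ x ∈ I, (u - x) ^ 2 ≤ (2 * a - u - x) ^ 2 := fun u hu x hx => by
    nlinarith [hside u hu x hx]
  refine exists_extension_of_involution (ψ' := fun _ => -1) hI hI subset_rfl (by fun_prop)
    measurable_const (fun u _ => ?_) (fun u _ => by ring) hmaps himage (fun u _ v _ => ?_)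
    (fun u _ v _ => ?_) (fun u hu x hx => sq_le_sq.1 (hcross u hu x hx))
    (fun u hu x hx => by simpa using hcross u hu x hx) (fun s hs => ?_)
    (fun s _ => ⟨1, fun u _ => by simp⟩)
  · simpa using (hasDerivAt_id u).const_sub (2 * a)
  · rw [abs_sub_comm]
    exact le_of_eq (congrArg _ (by ring))
  · simp only [abs_neg, abs_one]
    exact le_of_eq (by ring)
  · obtain ⟨r, hr⟩ := (isBounded_iff_forall_norm_le.1 hs)
    refine isBounded_iff_forall_norm_le.2 ⟨|2 * a| + r, fun u hu => ?_⟩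
    have h := hr _ hu.2
    rw [Real.norm_eq_abs] at h ⊢
    calc |u| = |2 * a - (2 * a - u)| := by congr 1; ring
      _ ≤ |2 * a| + |2 * a - u| := abs_sub _ _
      _ ≤ _ := by gcongr

/-- Extension from a bounded interval by inversion in the circle having it as a diameter. -/
lemma exists_extension_of_inversion (c : ℝ) {R : ℝ} (hR : 0 < R) :
    ∃ C : ℝ, 0 < C ∧ ∀ f : ℝ → ℝ, LocIntOn (Ioo (c - R) (c + R)) f →
      screenedSeminorm (Ioo (c - R) (c + R)) 1 f < ⊤ →
      ∃ ftilde : ℝ → ℝ, LocIntOn Set.univ ftilde ∧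
        (∀ᵐ x ∂volume.restrict (Ioo (c - R) (c + R)), ftilde x = f x) ∧
        screenedSeminorm Set.univ 1 ftilde ≤
          ENNReal.ofReal C * screenedSeminorm (Ioo (c - R) (c + R)) 1 f := by
  have hmem : ∀ x, x ∈ Ioo (c - R) (c + R) ↔ (x - c) ^ 2 < R ^ 2 := fun x => by
    rw [sq_lt_sq, abs_of_pos hR, abs_lt]
    constructor
    · rintro ⟨h₁, h₂⟩
      constructor <;> linarith
    · rintro ⟨h₁, h₂⟩
      constructor <;> linarith
  have hcross : ∀ u ∈ Ioo (c - R) (c + R) \ {c}, ∀ x ∈ Ioo (c - R) (c + R),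
      R ^ 2 / (u - c) ^ 2 * (u - x) ^ 2 ≤ (c + R ^ 2 / (u - c) - x) ^ 2 := by
    rintro u ⟨hu, huc⟩ x hx
    rw [hmem] at hu hx
    have ht : u - c ≠ 0 := sub_ne_zero.2 huc
    have h : (c + R ^ 2 / (u - c) - x) ^ 2 =
        (R ^ 2 - (u - c) * (x - c)) ^ 2 / (u - c) ^ 2 := by
      field_simp
      ring
    rw [h, div_mul_eq_mul_div]
    gcongr
    nlinarith [mul_nonneg (sub_nonneg.2 hu.le) (sub_nonneg.2 hx.le)]
  have hone : ∀ u ∈ Ioo (c - R) (c + R) \ {c}, 1 ≤ R ^ 2 / (u - c) ^ 2 := by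
    rintro u ⟨hu, huc⟩
    have ht : u - c ≠ 0 := sub_ne_zero.2 huc
    rw [one_le_div (by positivity)]
    exact ((hmem u).1 hu).le
  have hdiff : ∀ u ∈ Ioo (c - R) (c + R) \ {c}, ∀ v ∈ Ioo (c - R) (c + R) \ {c},
      R ^ 2 / (u - c) ^ 2 * (R ^ 2 / (v - c) ^ 2) * (v - u) ^ 2 =
        (c + R ^ 2 / (v - c) - (c + R ^ 2 / (u - c))) ^ 2 := by
    rintro u ⟨-, huc⟩ v ⟨-, hvc⟩
    have ht : u - c ≠ 0 := sub_ne_zero.2 huc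
    have ht' : v - c ≠ 0 := sub_ne_zero.2 hvc
    field_simp
    ring
  have habs : ∀ u, |-(R ^ 2) / (u - c) ^ 2| = R ^ 2 / (u - c) ^ 2 := fun u => by
    rw [neg_div, abs_neg, abs_of_nonneg (by positivity)]
  have hinvol : ∀ u, u ≠ c → c + R ^ 2 / (c + R ^ 2 / (u - c) - c) = u := fun u huc => by
    have ht : u - c ≠ 0 := sub_ne_zero.2 huc
    rw [add_sub_cancel_left]
    field_simp
    ring
  refine exists_extension_of_involution (I₀ := Ioo (c - R) (c + R) \ {c})
    (ψ := fun u => c + R ^ 2 / (u - c)) (ψ' := fun u => -(R ^ 2) / (u - c) ^ 2)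
    measurableSet_Ioo (measurableSet_Ioo.diff (measurableSet_singleton c)) sdiff_subset
    (by fun_prop) (by fun_prop) ?_ (fun u hu => hinvol u hu.2) ?_ ?_ ?_ ?_ ?_ ?_ ?_ ?_
  · rintro u ⟨-, huc⟩
    have h := (((hasDerivAt_id u).sub_const c).fun_inv (sub_ne_zero.2 huc)).const_mul (R ^ 2)
      |>.const_add c
    refine h.congr_deriv ?_
    simp only [id]
    ring
  · rintro u ⟨hu, huc⟩ h
    rw [hmem] at hu h
    have ht : 0 < (u - c) ^ 2 := by
      have := sub_ne_zero.2 huc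
      positivity
    rw [add_sub_cancel_left, div_pow, div_lt_iff₀ ht] at h
    nlinarith [pow_pos hR 2]
  · have hsub : (fun u => c + R ^ 2 / (u - c)) '' (Ioo (c - R) (c + R) \ {c})
        = {x | R ^ 2 < (x - c) ^ 2} := by
      ext x
      constructor
      · rintro ⟨u, ⟨hu, huc⟩, rfl⟩
        rw [hmem] at hu
        have ht : 0 < (u - c) ^ 2 := by
          have := sub_ne_zero.2 huc
          positivity
        rw [mem_ofPred_eq, add_sub_cancel_left, div_pow, lt_div_iff₀ ht]
        nlinarith [pow_pos hR 2]
      · intro hx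
        rw [mem_ofPred_eq] at hx
        have hsq : 0 < (x - c) ^ 2 := (pow_pos hR 2).trans hx
        have hxc : x - c ≠ 0 := fun h => by simp [h] at hsq
        refine ⟨c + R ^ 2 / (x - c), ⟨?_, ?_⟩, hinvol x (sub_ne_zero.1 hxc)⟩
        · rw [hmem, add_sub_cancel_left, div_pow, div_lt_iff₀ hsq]
          nlinarith [pow_pos hR 2]
        · simp [hxc, hR.ne']
    rw [hsub]
    have hnull : ∀ᵐ x : ℝ, x ∉ ({c - R, c + R} : Set ℝ) :=
      measure_eq_zero_iff_ae_notMem.1 ((Set.toFinite _).measure_zero volume)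
    filter_upwards [hnull] with x hx
    refine propext ?_
    change x ∉ Ioo (c - R) (c + R) ↔ R ^ 2 < (x - c) ^ 2
    rw [hmem, not_lt, le_iff_lt_or_eq, or_iff_left]
    intro h
    rcases sq_eq_sq_iff_eq_or_eq_neg.1 h with h | h
    · exact hx (Or.inr (by rw [mem_singleton_iff]; linarith))
    · exact hx (Or.inl (by linarith))
  · intro u hu v hv
    rw [← sq_le_sq, ← hdiff u hu v hv]
    exact le_mul_of_one_le_left (sq_nonneg _)
      (one_le_mul_of_one_le_of_one_le (hone u hu) (hone v hv))
  · intro u hu v hv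
    rw [habs, habs]
    exact (hdiff u hu v hv).le
  · intro u hu x hx
    rw [← sq_le_sq]
    exact (le_mul_of_one_le_left (sq_nonneg _) (hone u hu)).trans (hcross u hu x hx)
  · intro u hu x hx
    rw [habs]
    exact hcross u hu x hx
  · intro s _
    exact (Metric.isBounded_Ioo _ _).subset (inter_subset_left.trans sdiff_subset)
  · intro s hs
    obtain ⟨r, hr⟩ := isBounded_iff_forall_norm_le.1 hs
    refine ⟨(r + |c|) ^ 2 / R ^ 2, fun u hu => ?_⟩
    have h := hr _ hu.2
    have ht : u - c ≠ 0 := sub_ne_zero.2 hu.1.2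
    have h' : |R ^ 2 / (u - c)| ≤ r + |c| := by
      calc |R ^ 2 / (u - c)| = |(c + R ^ 2 / (u - c)) - c| := by congr 1; ring
        _ ≤ |c + R ^ 2 / (u - c)| + |c| := abs_sub _ _
        _ ≤ _ := by gcongr; exact h
    rw [habs, le_div_iff₀ (by positivity)]
    calc R ^ 2 / (u - c) ^ 2 * R ^ 2 = |R ^ 2 / (u - c)| ^ 2 := by
          rw [sq_abs]
          field_simp
      _ ≤ _ := by gcongr

/-- extension from a nonempty open interval `I` (bounded or a half-line)
to the whole line: there is `C > 0` depending only on `I` such that every locally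
integrable `f` with `|f|_{Ḣ^{1/2}(I)} < ∞` admits a locally integrable extension
`f̃ : ℝ → ℝ` with `f̃ = f` a.e. on `I` and `|f̃|_{Ḣ^{1/2}(ℝ)} ≤ C |f|_{Ḣ^{1/2}(I)}`. -/
theorem statement10 (I : Set ℝ)
    (hI : (∃ a b : ℝ, a < b ∧ I = Set.Ioo a b) ∨ (∃ a : ℝ, I = Set.Ioi a) ∨
      (∃ a : ℝ, I = Set.Iio a)) :
    ∃ C : ℝ, 0 < C ∧ ∀ f : ℝ → ℝ, LocIntOn I f → screenedSeminorm I 1 f < ⊤ →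
      ∃ ftilde : ℝ → ℝ, LocIntOn Set.univ ftilde ∧
        (∀ᵐ x ∂volume.restrict I, ftilde x = f x) ∧
        screenedSeminorm Set.univ 1 ftilde ≤ ENNReal.ofReal C * screenedSeminorm I 1 f := by
  rcases hI with ⟨a, b, hab, rfl⟩ | ⟨a, rfl⟩ | ⟨a, rfl⟩
  · have h := exists_extension_of_inversion ((a + b) / 2) (R := (b - a) / 2) (by linarith)
    rwa [show (a + b) / 2 - (b - a) / 2 = a by ring,
      show (a + b) / 2 + (b - a) / 2 = b by ring] at h
  · refine exists_extension_of_reflection (a := a) measurableSet_Ioi (fun u hu h => ?_) ?_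
      (fun u hu x hx => mul_nonneg (sub_nonneg.2 (le_of_lt hu)) (sub_nonneg.2 (le_of_lt hx)))
    · simp only [mem_Ioi] at hu h
      linarith
    · rw [compl_Ioi, image_const_sub_Ioi, two_mul, add_sub_cancel_right]
      exact Iio_ae_eq_Iic.symm
  · refine exists_extension_of_reflection (a := a) measurableSet_Iio (fun u hu h => ?_) ?_
      (fun u hu x hx =>
        mul_nonneg_of_nonpos_of_nonpos (sub_nonpos.2 (le_of_lt hu)) (sub_nonpos.2 (le_of_lt hx)))
    · simp only [mem_Iio] at hu h
      linarith
    · rw [compl_Iio, image_const_sub_Iio, two_mul, add_sub_cancel_right]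
      exact Ioi_ae_eq_Ici.symm
end
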